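/- arXiv:2006.16246 — 4 statements merged into one kernel-verified Lean document; each statement's English description precedes it below -/
import Mathlib

section
/- Let T : ℝ² → [0,1] be measurable with T(−p_x, p_y) = T(p_x, p_y) for all p, and set R = 1 − T. Let w¹, w² : ℝ² → ℝ be measurable with v_x w¹ and v_x w² integrable on ℝ². Suppose the kinetic transmission conditions hold: w¹(p) = R(p) w¹(∼p) + T(p) w²(p) for almost every p with p_x < 0, and w²(p) = R(p) w²(∼p) + T(p) w¹(p) for almost every p with p_x > 0. Then the fluxes at the interface coincide: ∫_{ℝ²} v_x(p) w¹(p) dp = ∫_{ℝ²} v_x(p) w²(p) dp. -/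
open MeasureTheory Real Set Filter

noncomputable section

/-- Euclidean norm of `p ∈ ℝ²` (realized as `ℝ × ℝ`). -/
def pnorm (p : ℝ × ℝ) : ℝ := Real.sqrt (p.1 ^ 2 + p.2 ^ 2)

/-- `x`-component of the semiclassical velocity `v(p) = v_F p/|p|`. -/
def vx (vF : ℝ) (p : ℝ × ℝ) : ℝ := vF * p.1 / pnorm p

/-- Fermi integral of order `k`. -/
def fermiInt (k z : ℝ) : ℝ :=
  (1 / Real.Gamma k) * ∫ t in Set.Ioi (0 : ℝ), t ^ (k - 1) / (Real.exp (t - z) + 1)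

/-- The constant `n₀ = 2π/(β h v_F)²`. -/
def n0 (β vF h : ℝ) : ℝ := 2 * Real.pi / (β * h * vF) ^ 2

/-- Fermi–Dirac distribution with chemical potential `A`. -/
def FD (β vF A : ℝ) (p : ℝ × ℝ) : ℝ := 1 / (Real.exp (β * (vF * pnorm p - A)) + 1)

/-- Linearized Fermi–Dirac distribution. -/
def LFD (β vF h A : ℝ) (p : ℝ × ℝ) : ℝ :=
  (FD β vF A p) ^ 2 * Real.exp (β * (vF * pnorm p - A)) / (n0 β vF h * fermiInt 1 (β * A))

lemma measurePreserving_neg_fst :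
    MeasurePreserving (fun p : ℝ × ℝ => (-p.1, p.2)) :=
  (Measure.measurePreserving_neg (volume : Measure ℝ)).prod (MeasurePreserving.id volume)

lemma integral_comp_neg_fst (f : ℝ × ℝ → ℝ) :
    ∫ p : ℝ × ℝ, f (-p.1, p.2) = ∫ p, f p :=
  measurePreserving_neg_fst.integral_comp
    ((MeasurableEquiv.neg ℝ).prodCongr (MeasurableEquiv.refl ℝ)).measurableEmbedding f

lemma integral_eq_zero_of_ae_neg_fst {f : ℝ × ℝ → ℝ}
    (hf : ∀ᵐ p : ℝ × ℝ, f (-p.1, p.2) = -f p) : ∫ p, f p = 0 := by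
  have h := integral_congr_ae hf
  rw [integral_comp_neg_fst, integral_neg] at h
  linarith

lemma vx_neg_fst (vF : ℝ) (p : ℝ × ℝ) : vx vF (-p.1, p.2) = -vx vF p := by
  simp [vx, pnorm, neg_div]

/-- Conservation of the particle flux across a quantum interface with reflection/transmission
coefficients, in the case of zero potential drop. -/
theorem stmt1 (vF : ℝ) (hvF : 0 < vF)
    (T : ℝ × ℝ → ℝ) (hTmeas : Measurable T) (hT01 : ∀ p, T p ∈ Set.Icc (0 : ℝ) 1)
    (hTsym : ∀ p : ℝ × ℝ, T (-p.1, p.2) = T p)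
    (w1 w2 : ℝ × ℝ → ℝ) (hw1 : Measurable w1) (hw2 : Measurable w2)
    (hi1 : Integrable (fun p => vx vF p * w1 p))
    (hi2 : Integrable (fun p => vx vF p * w2 p))
    (hKTC1 : ∀ᵐ p : ℝ × ℝ, p.1 < 0 →
      w1 p = (1 - T p) * w1 (-p.1, p.2) + T p * w2 p)
    (hKTC2 : ∀ᵐ p : ℝ × ℝ, 0 < p.1 →
      w2 p = (1 - T p) * w2 (-p.1, p.2) + T p * w1 p) :
    ∫ p : ℝ × ℝ, vx vF p * w1 p = ∫ p : ℝ × ℝ, vx vF p * w2 p := by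
  rw [← sub_eq_zero, ← integral_sub hi1 hi2]
  apply integral_eq_zero_of_ae_neg_fst
  have hσ := measurePreserving_neg_fst.quasiMeasurePreserving
  filter_upwards [hKTC1, hKTC2, hσ.ae hKTC1, hσ.ae hKTC2] with p h1 h2 h1' h2'
  simp only [hTsym, neg_neg, Prod.mk.eta, neg_pos, Left.neg_neg_iff] at h1' h2'
  rw [vx_neg_fst]
  rcases lt_trichotomy p.1 0 with hp | hp | hp
  · linear_combination vx vF p * h2' hp + vx vF p * h1 hp
  · simp [vx, hp]
  · linear_combination -vx vF p * h1' hp - vx vF p * h2 hp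
end
end

section
/- For every A ∈ ℝ and every i, j ∈ {1, 2}, ∫_{ℝ²} L_A(p) v_i(p) v_j(p) dp = (h² v_F²/2) δ_{ij}, where δ_{ij} is the Kronecker delta; that is, the matrix ∫_{ℝ²} L_A(p) v(p) ⊗ v(p) dp equals (h² v_F²/2) times the 2×2 identity matrix. -/
open MeasureTheory Real Set Filter

noncomputable section

/-- `i`-th component of the semiclassical velocity `v(p) = v_F p/|p|`. -/
def vcomp (vF : ℝ) (i : Fin 2) (p : ℝ × ℝ) : ℝ :=
  vF * (if i = 0 then p.1 else p.2) / pnorm p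

theorem pnorm_polar {r : ℝ} (hr : 0 < r) (θ : ℝ) : pnorm (r * cos θ, r * sin θ) = r := by
  have h : (r * cos θ) ^ 2 + (r * sin θ) ^ 2 = r ^ 2 := by
    linear_combination r ^ 2 * cos_sq_add_sin_sq θ
  rw [pnorm, h, Real.sqrt_sq hr.le]

theorem hasDerivAt_log_one_add_exp_sub (z s : ℝ) :
    HasDerivAt (fun s ↦ log (1 + exp (z - s))) (-(1 / (exp (s - z) + 1))) s := by
  have h := ((((hasDerivAt_id' s).const_sub z).exp).const_add 1).log (by positivity)
  convert h using 1
  have : exp (z - s) * exp (s - z) = 1 := by rw [← exp_add]; simp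
  field_simp
  linarith

theorem tendsto_log_one_add_exp_sub (z : ℝ) :
    Tendsto (fun s ↦ log (1 + exp (z - s))) atTop (nhds 0) := by
  have h : Tendsto (fun s ↦ exp (z - s)) atTop (nhds 0) :=
    tendsto_exp_atBot.comp (tendsto_atBot_add_const_left _ z tendsto_neg_atTop_atBot)
  have := (h.const_add 1).log (by norm_num)
  simpa using this

theorem tendsto_div_exp_sub_add_one (z : ℝ) :
    Tendsto (fun s ↦ s / (exp (s - z) + 1)) atTop (nhds 0) := by
  have h : Tendsto (fun s : ℝ ↦ exp z * (s ^ 1 * exp (-s))) atTop (nhds 0) := by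
    simpa using (tendsto_pow_mul_exp_neg_atTop_nhds_zero 1).const_mul (exp z)
  refine squeeze_zero' ?_ ?_ h
  · filter_upwards [eventually_ge_atTop 0] with s hs
    positivity
  · filter_upwards [eventually_ge_atTop 0] with s hs
    have : exp z * (s ^ 1 * exp (-s)) = s / exp (s - z) := by
      rw [exp_sub, exp_neg]
      field_simp
    rw [this]
    gcongr
    linarith

theorem fermiInt_one (z : ℝ) : fermiInt 1 z = log (1 + exp z) := by
  have h := integral_Ioi_of_hasDerivAt_of_nonneg' (a := 0)
    (fun s _ ↦ (hasDerivAt_log_one_add_exp_sub z s).neg)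
    (fun s _ ↦ by rw [neg_neg]; positivity) (tendsto_log_one_add_exp_sub z).neg
  simpa [fermiInt] using h

/-- Integration by parts against the Fermi window function. -/
theorem integral_mul_fermi_window (z : ℝ) :
    ∫ s in Ioi (0 : ℝ), s * (exp (s - z) / (exp (s - z) + 1) ^ 2) = log (1 + exp z) := by
  have hd (s : ℝ) : HasDerivAt (fun s ↦ -(s / (exp (s - z) + 1)) - log (1 + exp (z - s)))
      (s * (exp (s - z) / (exp (s - z) + 1) ^ 2)) s := by
    have h := ((hasDerivAt_id' s).div ((((hasDerivAt_id' s).sub_const z).exp).add_const 1)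
      (by positivity)).neg.sub (hasDerivAt_log_one_add_exp_sub z s)
    refine h.congr_deriv ?_
    field_simp
    ring
  have h := integral_Ioi_of_hasDerivAt_of_nonneg' (a := 0) (fun s _ ↦ hd s)
    (fun s hs ↦ by have : 0 < s := hs; positivity)
    ((tendsto_div_exp_sub_add_one z).neg.sub (tendsto_log_one_add_exp_sub z))
  simpa using h

/-- The unit vector at angle `θ`, by components. -/
def angular (i : Fin 2) (θ : ℝ) : ℝ := if i = 0 then cos θ else sin θ

theorem integral_angular_mul (i j : Fin 2) :
    ∫ θ in Ioo (-π) π, angular i θ * angular j θ = π * (if i = j then 1 else 0) := by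
  rw [← integral_Ioc_eq_integral_Ioo, ← intervalIntegral.integral_of_le (by linarith [pi_pos])]
  have hcs : ∫ θ in (-π)..π, sin θ * cos θ = 0 := by
    rw [integral_sin_mul_cos₁]; simp
  fin_cases i <;> fin_cases j <;> simp [angular]
  · simp_rw [← pow_two, integral_cos_sq]; simp
  · simpa only [mul_comm] using hcs
  · simp_rw [← pow_two, integral_sin_sq]; simp

theorem integral_radial {β vF : ℝ} (hβ : 0 < β) (hvF : 0 < vF) (A : ℝ) :
    ∫ r in Ioi (0 : ℝ), r * (exp (β * (vF * r - A)) / (exp (β * (vF * r - A)) + 1) ^ 2)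
      = log (1 + exp (β * A)) / (β * vF) ^ 2 := by
  have h := integral_comp_mul_left_Ioi
    (fun s ↦ s * (exp (s - β * A) / (exp (s - β * A) + 1) ^ 2)) 0 (mul_pos hβ hvF)
  simp only [mul_zero, integral_mul_fermi_window, smul_eq_mul, mul_assoc (β * vF),
    integral_const_mul] at h
  have he (r : ℝ) : β * vF * r - β * A = β * (vF * r - A) := by ring
  simp only [he] at h
  field_simp at h ⊢
  linarith

/-- The second moment identity `∫ L_A v ⊗ v dp = (h² v_F²/2) I`. -/
theorem stmt4 (β vF h : ℝ) (hβ : 0 < β) (hvF : 0 < vF) (hh : 0 < h) (A : ℝ)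
    (i j : Fin 2) :
    ∫ p : ℝ × ℝ, LFD β vF h A p * vcomp vF i p * vcomp vF j p
      = (h ^ 2 * vF ^ 2 / 2) * (if i = j then 1 else 0) := by
  have hpt : ∀ q ∈ polarCoord.target,
      q.1 • (LFD β vF h A (polarCoord.symm q) * vcomp vF i (polarCoord.symm q)
        * vcomp vF j (polarCoord.symm q))
      = vF ^ 2 / (n0 β vF h * fermiInt 1 (β * A)) *
        ((q.1 * (exp (β * (vF * q.1 - A)) / (exp (β * (vF * q.1 - A)) + 1) ^ 2))
          * (angular i q.2 * angular j q.2)) := by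
    rintro ⟨r, θ⟩ ⟨hr, -⟩
    have hr : 0 < r := hr
    have hv (i : Fin 2) : vcomp vF i (r * cos θ, r * sin θ) = vF * angular i θ := by
      unfold vcomp angular
      rw [pnorm_polar hr]
      split_ifs <;> field_simp
    simp only [polarCoord_symm_apply, hv, LFD, FD, pnorm_polar hr, smul_eq_mul, one_div, inv_pow]
    ring
  rw [← integral_comp_polarCoord_symm, setIntegral_congr_fun polarCoord.open_target.measurableSet
    hpt, integral_const_mul, polarCoord_target, Measure.volume_eq_prod,
    setIntegral_prod_mul (fun r ↦ r * (exp (β * (vF * r - A)) / (exp (β * (vF * r - A)) + 1) ^ 2))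
      (fun θ ↦ angular i θ * angular j θ), integral_radial hβ hvF, integral_angular_mul,
    fermiInt_one, n0]
  have hlog : log (1 + exp (β * A)) ≠ 0 :=
    (log_pos (by linarith [exp_pos (β * A)])).ne'
  have := pi_pos.ne'
  field_simp
end
end

section
/- For every A ∈ ℝ, the linearized Fermi–Dirac distribution is normalized: (1/h²) ∫_{ℝ²} L_A(p) dp = 1. -/
open MeasureTheory Real Set Filter

noncomputable section

theorem integrableOn_fermi_one (z : ℝ) :
    IntegrableOn (fun t : ℝ => 1 / (Real.exp (t - z) + 1)) (Ioi 0) := by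
  have hg : IntegrableOn (fun t : ℝ => Real.exp z * Real.exp (-t)) (Ioi 0) :=
    Integrable.const_mul (integrableOn_exp_neg_Ioi 0) (Real.exp z)
  refine Integrable.mono' hg (Measurable.aestronglyMeasurable (by fun_prop)) (ae_of_all _ fun t => ?_)
  rw [Real.norm_of_nonneg (by positivity), ← Real.exp_add, div_le_iff₀ (by positivity)]
  have h1 : Real.exp (z + -t) * Real.exp (t - z) = 1 := by
    rw [← Real.exp_add, Real.exp_eq_one_iff]; ring
  nlinarith [Real.exp_pos (z + -t)]

theorem integrableOn_mul_fermi_deriv (z : ℝ) :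
    IntegrableOn (fun t : ℝ => t * (Real.exp (t - z) / (Real.exp (t - z) + 1) ^ 2)) (Ioi 0) := by
  have hg : IntegrableOn (fun t : ℝ => Real.exp z * (Real.exp (-t) * t)) (Ioi 0) := by
    have := (Real.GammaIntegral_convergent (s := 2) (by norm_num)).const_mul (Real.exp z)
    norm_num at this
    exact this
  refine Integrable.mono' hg (Measurable.aestronglyMeasurable (by fun_prop)) ?_
  filter_upwards [ae_restrict_mem measurableSet_Ioi] with t ht
  have ht : 0 < t := ht
  rw [Real.norm_of_nonneg (by positivity)]
  have key : Real.exp (t - z) / (Real.exp (t - z) + 1) ^ 2 ≤ Real.exp z * Real.exp (-t) := by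
    rw [← Real.exp_add, div_le_iff₀ (by positivity)]
    have h1 : Real.exp (z + -t) * Real.exp (t - z) = 1 := by
      rw [← Real.exp_add, Real.exp_eq_one_iff]; ring
    have h2 : Real.exp (z + -t) * (Real.exp (t - z) + 1) ^ 2
        = Real.exp (t - z) + 2 + Real.exp (z + -t) := by
      linear_combination (Real.exp (t - z) + 2) * h1
    linarith [Real.exp_pos (z + -t)]
  calc _ ≤ t * (Real.exp z * Real.exp (-t)) := by gcongr
    _ = _ := by ring

/-- Integration by parts relating the Fermi integral to the derivative of its kernel. -/
theorem integral_mul_fermi_deriv (z : ℝ) :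
    ∫ t in Ioi (0 : ℝ), t * (Real.exp (t - z) / (Real.exp (t - z) + 1) ^ 2)
      = ∫ t in Ioi (0 : ℝ), 1 / (Real.exp (t - z) + 1) := by
  have hd : ∀ t ∈ Ici (0 : ℝ), HasDerivAt (fun t : ℝ => t / (Real.exp (t - z) + 1))
      (1 / (Real.exp (t - z) + 1) - t * (Real.exp (t - z) / (Real.exp (t - z) + 1) ^ 2)) t := by
    intro t _
    have hne : Real.exp (t - z) + 1 ≠ 0 := by positivity
    have := (hasDerivAt_id t).div ((((hasDerivAt_id t).sub_const z).exp).add_const 1) hne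
    refine HasDerivAt.congr_deriv this ?_
    simp only [id]
    field_simp
  have hlim : Tendsto (fun t : ℝ => t / (Real.exp (t - z) + 1)) atTop (nhds 0) := by
    have h0 : Tendsto (fun t : ℝ => Real.exp z * (t ^ 1 * Real.exp (-t))) atTop (nhds 0) := by
      simpa using (Real.tendsto_pow_mul_exp_neg_atTop_nhds_zero 1).const_mul (Real.exp z)
    refine squeeze_zero' ?_ ?_ h0
    · filter_upwards [eventually_ge_atTop 0] with t ht
      positivity
    · filter_upwards [eventually_ge_atTop 0] with t ht
      rw [div_le_iff₀ (by positivity)]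
      have h1 : Real.exp z * Real.exp (-t) * Real.exp (t - z) = 1 := by
        rw [← Real.exp_add, ← Real.exp_add, Real.exp_eq_one_iff]; ring
      have h2 : 0 ≤ t * (Real.exp z * Real.exp (-t)) := by positivity
      linear_combination h2 - t * h1
  have hi := (integrableOn_fermi_one z).sub (integrableOn_mul_fermi_deriv z)
  have h := integral_Ioi_of_hasDerivAt_of_tendsto' hd hi hlim
  rw [integral_sub (integrableOn_fermi_one z) (integrableOn_mul_fermi_deriv z)] at h
  simp only [zero_div, sub_zero] at h
  linarith

theorem fermiInt_one_s5 (z : ℝ) :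
    fermiInt 1 z = ∫ t in Ioi (0 : ℝ), 1 / (Real.exp (t - z) + 1) := by
  simp [fermiInt]

theorem fermiInt_one_pos (z : ℝ) : 0 < fermiInt 1 z := by
  rw [fermiInt_one_s5, setIntegral_pos_iff_support_of_nonneg_ae
    (ae_of_all _ fun t => by simp only [Pi.zero_apply]; positivity) (integrableOn_fermi_one z)]
  have : Function.support (fun t : ℝ => 1 / (Real.exp (t - z) + 1)) = univ := by
    ext t
    have : Real.exp (t - z) + 1 ≠ 0 := by positivity
    simpa using this
  rw [this]
  simp

theorem pnorm_polarCoord_symm {q : ℝ × ℝ} (hq : 0 < q.1) : pnorm (polarCoord.symm q) = q.1 := by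
  rw [pnorm, polarCoord_symm_apply, Real.sqrt_eq_iff_mul_self_eq (by positivity) hq.le]
  linear_combination q.1 ^ 2 * Real.sin_sq_add_cos_sq q.2

/-- Integration of radial functions over the plane. -/
theorem integral_comp_pnorm (g : ℝ → ℝ) :
    ∫ p : ℝ × ℝ, g (pnorm p) = 2 * Real.pi * ∫ r in Ioi (0 : ℝ), r * g r := by
  rw [← integral_comp_polarCoord_symm]
  have h : ∫ q in polarCoord.target, q.1 • g (pnorm (polarCoord.symm q))
      = ∫ q in Ioi (0 : ℝ) ×ˢ Ioo (-Real.pi) Real.pi, (q.1 * g q.1) * (1 : ℝ) := by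
    refine setIntegral_congr_fun (measurableSet_Ioi.prod measurableSet_Ioo) fun q hq => ?_
    simp only [smul_eq_mul, mul_one, pnorm_polarCoord_symm (mem_Ioi.1 hq.1)]
  rw [h, Measure.volume_eq_prod,
    setIntegral_prod_mul (fun r : ℝ => r * g r) (fun _ : ℝ => (1 : ℝ))]
  have h2 : ∫ _ in Ioo (-Real.pi) Real.pi, (1 : ℝ) = 2 * Real.pi := by
    simp [Real.pi_pos.le, two_mul]
  rw [h2, mul_comm]

/-- The linearized Fermi–Dirac distribution is normalized: `(1/h²) ∫ L_A dp = 1`. -/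
theorem stmt5 (β vF h : ℝ) (hβ : 0 < β) (hvF : 0 < vF) (hh : 0 < h) (A : ℝ) :
    (1 / h ^ 2) * ∫ p : ℝ × ℝ, LFD β vF h A p = 1 := by
  have hc : 0 < β * vF := mul_pos hβ hvF
  have hJ := fermiInt_one_pos (β * A)
  set G : ℝ → ℝ := fun t =>
    t * (Real.exp (t - β * A) / (Real.exp (t - β * A) + 1) ^ 2) with hG
  have hint : ∫ t in Ioi (0 : ℝ), G t = fermiInt 1 (β * A) := by
    rw [fermiInt_one_s5, hG, integral_mul_fermi_deriv]
  have hscale : ∫ r in Ioi (0 : ℝ), G (β * vF * r) = (β * vF)⁻¹ * fermiInt 1 (β * A) := by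
    rw [integral_comp_mul_left_Ioi G 0 hc, mul_zero, hint, smul_eq_mul]
  have hrad := integral_comp_pnorm fun r => (1 / (Real.exp (β * (vF * r - A)) + 1)) ^ 2 *
    Real.exp (β * (vF * r - A))
  have hr : ∀ r : ℝ, r * ((1 / (Real.exp (β * (vF * r - A)) + 1)) ^ 2 *
      Real.exp (β * (vF * r - A))) = (β * vF)⁻¹ * G (β * vF * r) := by
    intro r
    have e : β * (vF * r - A) = β * vF * r - β * A := by ring
    simp only [hG, e]
    field_simp
  simp only [hr, integral_const_mul, hscale] at hrad
  simp only [LFD, FD, integral_div, hrad, n0]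
  have := Real.pi_pos
  field_simp
end
end

section
/- Let I ⊆ ℝ be an interval and let L : ℝ² → [0, ∞) be integrable with (1/h²) ∫_{ℝ²} L(p) dp = 1 and ∫_{ℝ²} v_x(p) L(p) dp = 0. Let θ : I × ℝ² → ℝ satisfy the Milne equation v_x(p) ∂_ξ θ(ξ, p) = L(p) ⟨θ(ξ, ·)⟩ − θ(ξ, p) for all ξ ∈ I and a.e. p ∈ ℝ² \ {0}, with the same integrability, differentiability and local domination hypotheses as before, and suppose the flux vanishes identically: ∫_{ℝ²} v_x(p) θ(ξ, p) dp = 0 for all ξ ∈ I. Then the variance ξ ↦ ∫_{ℝ²} v_x(p)² θ(ξ, p) dp is constant on I. -/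
open MeasureTheory Real Set Filter

noncomputable section

/-- A family of almost everywhere measurable functions depending continuously on a real parameter,
at almost every point, agrees almost everywhere with a jointly measurable family. -/
theorem exists_measurable_uncurry_of_ae_continuous {α : Type*} [MeasurableSpace α]
    {μ : Measure α} {f : ℝ → α → ℝ} (hf : ∀ ξ, AEMeasurable (f ξ) μ)
    (hc : ∀ᵐ p ∂μ, Continuous fun ξ => f ξ p) :
    ∃ g : ℝ → α → ℝ, Measurable (Function.uncurry g) ∧ ∀ᵐ p ∂μ, ∀ ξ, f ξ p = g ξ p := by
  have hgood : ∀ᵐ p ∂μ, (Continuous fun ξ => f ξ p) ∧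
      ∀ q : ℚ, f q p = (hf q).mk (f q) p :=
    hc.and (ae_all_iff.2 fun q : ℚ => (hf q).ae_eq_mk)
  obtain ⟨G, hGae, hGmeas, hGgood⟩ := hgood.exists_measurable_mem
  have hrat (q : ℚ) : Measurable (G.indicator (f q)) := by
    have : G.indicator (f q) = G.indicator ((hf q).mk (f q)) :=
      Set.indicator_congr fun p hp => (hGgood p hp).2 q
    rw [this]
    exact (hf q).measurable_mk.indicator hGmeas
  have hcont (p : α) : Continuous fun ξ => G.indicator (f ξ) p := by
    by_cases hp : p ∈ G
    · simpa [hp] using (hGgood p hp).1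
    · simpa [hp] using continuous_const
  have hmeas (ξ : ℝ) : Measurable (G.indicator (f ξ)) := by
    obtain ⟨u, hu, hlim⟩ := mem_closure_iff_seq_limit.1 (Rat.denseRange_cast (𝕜 := ℝ) ξ)
    choose q hq using hu
    refine measurable_of_tendsto_metrizable (fun n => hrat (q n)) (tendsto_pi_nhds.2 fun p => ?_)
    simp only [hq]
    exact ((hcont p).tendsto ξ).comp hlim
  refine ⟨fun ξ => G.indicator (f ξ), ?_, ?_⟩
  · exact measurable_uncurry_of_continuous_of_measurable hcont hmeas
  · filter_upwards [hGae] with p hp ξ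
    simp [hp]

/-- The parametric derivative of a family of measurable functions is jointly measurable. -/
theorem aestronglyMeasurable_uncurry_of_hasDerivAt {α : Type*} [MeasurableSpace α]
    {μ : Measure α} [SFinite μ] {a b : ℝ} (hab : a ≤ b) {f f' : ℝ → α → ℝ}
    (hf : ∀ ξ ∈ Icc a b, AEMeasurable (f ξ) μ)
    (hderiv : ∀ᵐ p ∂μ, ∀ ξ ∈ Icc a b, HasDerivAt (fun ζ => f ζ p) (f' ξ p) ξ) :
    AEStronglyMeasurable (Function.uncurry f') ((volume.restrict (Ioc a b)).prod μ) := by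
  obtain ⟨g, hg, hfg⟩ := exists_measurable_uncurry_of_ae_continuous
    (f := fun ξ => f (projIcc a b hab ξ)) (μ := μ) (fun ξ => hf _ (projIcc a b hab ξ).2) (by
      filter_upwards [hderiv] with p hp
      have : ContinuousOn (fun ζ => f ζ p) (Icc a b) :=
        fun ξ hξ => (hp ξ hξ).continuousAt.continuousWithinAt
      exact this.comp_continuous (continuous_subtype_val.comp continuous_projIcc)
        fun ξ => (projIcc a b hab ξ).2)
  let y (n : ℕ) (ξ : ℝ) : ℝ := ξ + (a - ξ) * (1 / ((n : ℝ) + 1))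
  have hy_meas (n : ℕ) : Measurable (y n) := by fun_prop
  have hq (n : ℕ) : AEMeasurable
      (fun z : ℝ × α => (y n z.1 - z.1)⁻¹ * (g (y n z.1) z.2 - g z.1 z.2))
      ((volume.restrict (Ioc a b)).prod μ) := by
    have h₁ : Measurable fun z : ℝ × α => g (y n z.1) z.2 :=
      hg.comp (((hy_meas n).comp measurable_fst).prodMk measurable_snd)
    exact (((((hy_meas n).comp measurable_fst).sub measurable_fst).inv).mul
      (h₁.sub hg)).aemeasurable
  refine (aemeasurable_of_tendsto_metrizable_ae atTop hq ?_).aestronglyMeasurable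
  have h₁ : ∀ᵐ z ∂((volume.restrict (Ioc a b)).prod μ), z.1 ∈ Ioc a b :=
    Measure.quasiMeasurePreserving_fst.ae (ae_restrict_mem measurableSet_Ioc)
  have h₂ := Measure.quasiMeasurePreserving_snd (μ := volume.restrict (Ioc a b)) |>.ae
    (hfg.and hderiv)
  filter_upwards [h₁, h₂] with z hz hz'
  obtain ⟨ξ, p⟩ := z
  obtain ⟨hgp, hdp⟩ := hz'
  simp only at hz hgp hdp ⊢
  have hgf {ζ : ℝ} (hζ : ζ ∈ Icc a b) : g ζ p = f ζ p := by
    rw [← hgp ζ, projIcc_of_mem hab hζ]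
  have hξ : ξ ∈ Icc a b := Ioc_subset_Icc_self hz
  have hpos (n : ℕ) : (0 : ℝ) < 1 / ((n : ℝ) + 1) := Nat.one_div_pos_of_nat
  have hle (n : ℕ) : 1 / ((n : ℝ) + 1) ≤ 1 := by
    rw [div_le_one (by positivity)]
    linarith [(Nat.cast_nonneg n : (0 : ℝ) ≤ n)]
  have hy_mem (n : ℕ) : y n ξ ∈ Icc a b := by
    constructor <;> simp only [y] <;> nlinarith [hz.1, hz.2, hpos n, hle n]
  have hy_ne (n : ℕ) : y n ξ ≠ ξ := by
    have := mul_neg_of_neg_of_pos (sub_neg.2 hz.1) (hpos n)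
    simp only [y]
    linarith
  have hy_tendsto : Tendsto (fun n => y n ξ) atTop (nhdsWithin ξ {ξ}ᶜ) := by
    refine tendsto_nhdsWithin_iff.2 ⟨?_, .of_forall hy_ne⟩
    simpa [y] using
      (tendsto_one_div_add_atTop_nhds_zero_nat (𝕜 := ℝ)).const_mul (a - ξ) |>.const_add ξ
  refine ((hdp ξ hξ).tendsto_slope.comp hy_tendsto).congr fun n => ?_
  simp [slope_def_module, hgf hξ, hgf (hy_mem n)]

/-- Newton–Leibniz under the integral sign, where the domination of the derivative may have an
exceptional null set depending on the parameter. -/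
theorem integral_mul_sub_eq_intervalIntegral {α : Type*} [MeasurableSpace α]
    {μ : Measure α} [SFinite μ] {a b C : ℝ} (hab : a ≤ b) {f f' : ℝ → α → ℝ} {g w : α → ℝ}
    (hf : ∀ ξ ∈ Icc a b, AEMeasurable (f ξ) μ)
    (hderiv : ∀ᵐ p ∂μ, ∀ ξ ∈ Icc a b, HasDerivAt (fun ζ => f ζ p) (f' ξ p) ξ)
    (hg : Integrable g μ) (hbound : ∀ ξ ∈ Icc a b, ∀ᵐ p ∂μ, |f' ξ p| ≤ g p)
    (hw : Measurable w) (hwC : ∀ p, |w p| ≤ C) :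
    ∫ p, w p * (f b p - f a p) ∂μ = ∫ ξ in a..b, ∫ p, w p * f' ξ p ∂μ := by
  have hmeas := aestronglyMeasurable_uncurry_of_hasDerivAt hab hf hderiv
  have hint : Integrable (Function.uncurry f') ((volume.restrict (Ioc a b)).prod μ) := by
    rw [integrable_prod_iff hmeas]
    refine ⟨?_, ?_⟩
    · filter_upwards [hmeas.prodMk_left, ae_restrict_mem measurableSet_Ioc] with ξ hm hξ
      exact hg.mono' hm (hbound ξ (Ioc_subset_Icc_self hξ))
    · refine (integrable_const (∫ p, g p ∂μ)).mono' hmeas.norm.integral_prod_right' ?_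
      filter_upwards [ae_restrict_mem measurableSet_Ioc] with ξ hξ
      rw [Real.norm_of_nonneg (integral_nonneg fun p => norm_nonneg _)]
      exact integral_mono_of_nonneg (.of_forall fun p => norm_nonneg _) hg
        (hbound ξ (Ioc_subset_Icc_self hξ))
  have hwint : Integrable (Function.uncurry fun ξ p => w p * f' ξ p)
      ((volume.restrict (Ioc a b)).prod μ) :=
    hint.bdd_mul (c := C) (hw.comp measurable_snd).aestronglyMeasurable
      (.of_forall fun z => hwC z.2)
  rw [intervalIntegral.integral_of_le hab, integral_integral_swap hwint]
  refine integral_congr_ae ?_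
  filter_upwards [hint.prod_left_ae, hderiv] with p hip hdp
  rw [integral_const_mul, ← intervalIntegral.integral_of_le hab,
    intervalIntegral.integral_eq_sub_of_hasDerivAt (f := fun ζ => f ζ p)
      (fun ξ hξ => hdp ξ (by rwa [uIcc_of_le hab] at hξ))
      ((intervalIntegrable_iff_integrableOn_Ioc_of_le hab).2 hip)]

theorem measurable_vx (vF : ℝ) : Measurable (vx vF) := by
  unfold vx pnorm
  fun_prop

theorem vx_zero (vF : ℝ) : vx vF 0 = 0 := by
  simp [vx]

theorem abs_vx_le {vF : ℝ} (hvF : 0 ≤ vF) (p : ℝ × ℝ) : |vx vF p| ≤ vF := by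
  have hp : |p.1| ≤ pnorm p := Real.abs_le_sqrt (by nlinarith [sq_nonneg p.2])
  have hn : 0 ≤ pnorm p := Real.sqrt_nonneg _
  rw [vx, abs_div, abs_mul, abs_of_nonneg hvF, abs_of_nonneg hn]
  exact div_le_of_le_mul₀ hn hvF (mul_le_mul_of_nonneg_left hp hvF)

theorem MeasureTheory.Integrable.vx_mul {vF : ℝ} (hvF : 0 ≤ vF) {f : ℝ × ℝ → ℝ}
    (hf : Integrable f) : Integrable fun p => vx vF p * f p :=
  hf.bdd_mul (c := vF) (measurable_vx vF).aestronglyMeasurable (.of_forall (abs_vx_le hvF))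

/-- If moreover `∫ v_x L dp = 0` and the flux vanishes identically, any sufficiently regular
solution of the Milne equation has constant variance `ξ ↦ ∫ v_x² θ(ξ,·) dp`. -/
theorem stmt16 (vF h : ℝ) (hvF : 0 < vF) (hh : 0 < h)
    (I : Set ℝ) (hI : I.OrdConnected)
    (L : ℝ × ℝ → ℝ) (hL0 : ∀ p, 0 ≤ L p) (hLint : Integrable L)
    (hLnorm : (1 / h ^ 2) * ∫ p : ℝ × ℝ, L p = 1)
    (hLvx : ∫ p : ℝ × ℝ, vx vF p * L p = 0)
    (θ Dθ : ℝ → ℝ × ℝ → ℝ)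
    (hθint : ∀ ξ ∈ I, Integrable (θ ξ))
    (hderiv : ∀ᵐ p : ℝ × ℝ, ∀ ξ ∈ I, HasDerivAt (fun ζ => θ ζ p) (Dθ ξ p) ξ)
    (hdom : ∀ a b : ℝ, Set.Icc a b ⊆ I → ∃ g : ℝ × ℝ → ℝ, Integrable g ∧
      ∀ ξ ∈ Set.Icc a b, ∀ᵐ p : ℝ × ℝ, |θ ξ p| ≤ g p ∧ |Dθ ξ p| ≤ g p)
    (hMilne : ∀ ξ ∈ I, ∀ᵐ p : ℝ × ℝ, p ≠ 0 →
      vx vF p * Dθ ξ p = L p * ((1 / h ^ 2) * ∫ q : ℝ × ℝ, θ ξ q) - θ ξ p)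
    (hflux : ∀ ξ ∈ I, ∫ p : ℝ × ℝ, vx vF p * θ ξ p = 0) :
    ∀ ξ₁ ∈ I, ∀ ξ₂ ∈ I,
      ∫ p : ℝ × ℝ, (vx vF p) ^ 2 * θ ξ₁ p = ∫ p : ℝ × ℝ, (vx vF p) ^ 2 * θ ξ₂ p := by
  have key : ∀ a ∈ I, ∀ b ∈ I, a ≤ b →
      ∫ p : ℝ × ℝ, (vx vF p) ^ 2 * θ a p = ∫ p : ℝ × ℝ, (vx vF p) ^ 2 * θ b p := by
    intro a ha b hb hab
    have hsub : Icc a b ⊆ I := hI.out ha hb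
    obtain ⟨g, hg, hgb⟩ := hdom a b hsub
    have hzero : ∀ ξ ∈ I, ∫ p : ℝ × ℝ, (vx vF p) ^ 2 * Dθ ξ p = 0 := by
      intro ξ hξ
      set c := (1 / h ^ 2) * ∫ q : ℝ × ℝ, θ ξ q
      have hae : (fun p => (vx vF p) ^ 2 * Dθ ξ p) =ᵐ[volume]
          fun p => c * (vx vF p * L p) - vx vF p * θ ξ p := by
        filter_upwards [hMilne ξ hξ] with p hp
        rcases eq_or_ne p 0 with rfl | hp0
        · simp [vx_zero]
        · linear_combination vx vF p * hp hp0
      rw [integral_congr_ae hae, integral_sub ((hLint.vx_mul hvF.le).const_mul c)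
        ((hθint ξ hξ).vx_mul hvF.le), integral_const_mul, hLvx, hflux ξ hξ]
      simp
    have hvar := integral_mul_sub_eq_intervalIntegral (C := vF ^ 2) hab
      (fun ξ hξ => (hθint ξ (hsub hξ)).aemeasurable)
      (hderiv.mono fun p hp ξ hξ => hp ξ (hsub hξ)) hg
      (fun ξ hξ => (hgb ξ hξ).mono fun p hp => hp.2) ((measurable_vx vF).pow_const 2)
      (fun p => by
        rw [abs_pow]
        exact pow_le_pow_left₀ (abs_nonneg _) (abs_vx_le hvF.le p) 2)
    have hsq : ∀ ξ ∈ I, Integrable fun p => (vx vF p) ^ 2 * θ ξ p := fun ξ hξ => by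
      simpa only [sq, mul_assoc] using ((hθint ξ hξ).vx_mul hvF.le).vx_mul hvF.le
    rw [intervalIntegral.integral_congr (g := fun _ => 0)
      (fun ξ hξ => hzero ξ (hsub (by rwa [uIcc_of_le hab] at hξ)))] at hvar
    simp only [mul_sub, integral_sub (hsq b hb) (hsq a ha),
      intervalIntegral.integral_zero] at hvar
    linarith
  intro ξ₁ h₁ ξ₂ h₂
  rcases le_total ξ₁ ξ₂ with hle | hle
  · exact key ξ₁ h₁ ξ₂ h₂ hle
  · exact (key ξ₂ h₂ ξ₁ h₁ hle).symm
end
end
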